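/- There is a Borel uniformly e-invariant function f : P(ℕ) → P(ℕ) such that: (1) for all X, Y ⊆ ℕ there is Z ⊆ ℕ with X ≤_e Z and f(Z) = Y; and (2) for every set A that is not c.e., f(A) <_e A (that is, f(A) ≤_e A and A ≰_e f(A)). In particular, f is not constant on any cone of enumeration degrees. -/

import Mathlib

open Classical

/-- The `e`-th computably enumerable subset of `ℕ` (the domain of the `e`-th
partial computable function). -/
def ceSet (e : ℕ) : Set ℕ :=
  {n | ((Denumerable.ofNat Nat.Partrec.Code e).eval n).Dom}

/-- The finite set canonically coded by `u` (via binary expansion). -/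
def finCode (u : ℕ) : Set ℕ := {n | Nat.testBit u n}

/-- The `i`-th enumeration operator applied to `B`. -/
def eOp (i : ℕ) (B : Set ℕ) : Set ℕ :=
  {n | ∃ u : ℕ, Nat.pair n u ∈ ceSet i ∧ finCode u ⊆ B}

/-- `A ≤ₑ B` via the index `i`. -/
def ELeVia (A B : Set ℕ) (i : ℕ) : Prop := A = eOp i B

/-- Enumeration reducibility. -/
def ELe (A B : Set ℕ) : Prop := ∃ i, ELeVia A B i

/-- `A ≡ₑ B` via the pair of indices `⟨i,j⟩`. -/
def EEquivVia (A B : Set ℕ) (i j : ℕ) : Prop := ELeVia A B i ∧ ELeVia B A j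

/-- Enumeration equivalence. -/
def EEquiv (A B : Set ℕ) : Prop := ELe A B ∧ ELe B A

/-- Strict enumeration reducibility. -/
def ELt (A B : Set ℕ) : Prop := ELe A B ∧ ¬ ELe B A

/-- The enumeration degree of `A`, i.e. its `≡ₑ`-class. -/
def edeg (A : Set ℕ) : Set (Set ℕ) := {B | EEquiv A B}

/-- `K_A = {⟨i,n⟩ : n ∈ Γ_i(A)}`. -/
def KSet (A : Set ℕ) : Set ℕ := {m | m.unpair.2 ∈ eOp m.unpair.1 A}

/-- The skip `A^⋄ = ℕ \ K_A`. -/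
def eSkip (A : Set ℕ) : Set ℕ := (KSet A)ᶜ

/-- `A ⊕ B = {2n : n ∈ A} ∪ {2n+1 : n ∈ B}`. -/
def eJoin (A B : Set ℕ) : Set ℕ :=
  {n | (∃ m ∈ A, n = 2 * m) ∨ (∃ m ∈ B, n = 2 * m + 1)}

/-- The enumeration jump `A' = K_A ⊕ (ℕ \ K_A)`. -/
def eJump (A : Set ℕ) : Set ℕ := eJoin (KSet A) (KSet A)ᶜ

/-- `u` is a uniformity function for `f` on the domain `D`. -/
def IsUniformityOn (D : Set (Set ℕ)) (f : Set ℕ → Set ℕ) (u : ℕ → ℕ) : Prop :=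
  ∀ A ∈ D, ∀ B ∈ D, ∀ i j : ℕ, EEquivVia A B i j →
    EEquivVia (f A) (f B) (u (Nat.pair i j)).unpair.1 (u (Nat.pair i j)).unpair.2

/-- `f` is uniformly e-invariant on the domain `D`. -/
def UniformlyEInvariantOn (D : Set (Set ℕ)) (f : Set ℕ → Set ℕ) : Prop :=
  ∃ u : ℕ → ℕ, IsUniformityOn D f u

/-- `f` is uniformly e-invariant. -/
def UniformlyEInvariant (f : Set ℕ → Set ℕ) : Prop :=
  UniformlyEInvariantOn Set.univ f

/-- `f` is e-invariant. -/
def EInvariant (f : Set ℕ → Set ℕ) : Prop :=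
  ∀ A B : Set ℕ, EEquiv A B → EEquiv (f A) (f B)

/-- `f ≤ₑ^▽ g`: `f` is e-below `g` on a cone. -/
def ConeLe (f g : Set ℕ → Set ℕ) : Prop :=
  ∃ D : Set ℕ, ∀ X : Set ℕ, ELe D X → ELe (f X) (g X)

/-- Borel functions on Cantor space `P(ℕ)`. -/
def BorelFun (F : Set ℕ → Set ℕ) : Prop := Measurable F

/-- `A` is computably enumerable. -/
def IsCE (A : Set ℕ) : Prop := ∃ e : ℕ, A = ceSet e


/-! ## Semidecidable predicates in normal form -/

def Sig {α : Type} [Primcodable α] (p : α → Prop) : Prop :=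
  ∃ q : α × ℕ → Bool, Primrec q ∧ ∀ a, p a ↔ ∃ s, q (a, s) = true

section SigLemmas
variable {α β : Type} [Primcodable α] [Primcodable β]

theorem Sig.of_iff {p q : α → Prop} (hp : Sig p) (h : ∀ a, q a ↔ p a) : Sig q := by
  obtain ⟨r, hr, h'⟩ := hp
  exact ⟨r, hr, fun a => (h a).trans (h' a)⟩

theorem Sig.of_prim {p : α → Prop} (hp : PrimrecPred p) : Sig p := by
  obtain ⟨hd, hp⟩ := hp
  exact ⟨fun x => decide (p x.1), hp.comp Primrec.fst, fun a => by simp⟩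

theorem Sig.comp {p : β → Prop} (hp : Sig p) {f : α → β} (hf : Primrec f) :
    Sig (fun a => p (f a)) := by
  obtain ⟨r, hr, h'⟩ := hp
  exact ⟨fun x => r (f x.1, x.2), hr.comp ((hf.comp Primrec.fst).pair Primrec.snd),
    fun a => h' _⟩

theorem Sig.and {p q : α → Prop} (hp : Sig p) (hq : Sig q) : Sig (fun a => p a ∧ q a) := by
  obtain ⟨r, hr, h⟩ := hp
  obtain ⟨r', hr', h'⟩ := hq
  have hu := Primrec.unpair.comp (Primrec.snd (α := α) (β := ℕ))
  refine ⟨fun x => r (x.1, x.2.unpair.1) && r' (x.1, x.2.unpair.2), ?_, fun a => ?_⟩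
  · exact Primrec.and.comp (hr.comp (Primrec.fst.pair (Primrec.fst.comp hu)))
      (hr'.comp (Primrec.fst.pair (Primrec.snd.comp hu)))
  · simp only [h, h']
    constructor
    · rintro ⟨⟨s, hs⟩, t, ht⟩
      exact ⟨Nat.pair s t, by simp [hs, ht]⟩
    · rintro ⟨s, hs⟩
      simp only [Bool.and_eq_true] at hs
      exact ⟨⟨_, hs.1⟩, _, hs.2⟩

theorem Sig.ex {p : α × β → Prop} (hp : Sig p) : Sig (fun a => ∃ b, p (a, b)) := by
  obtain ⟨r, hr, h⟩ := hp
  have hu := Primrec.unpair.comp (Primrec.snd (α := α) (β := ℕ))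
  refine ⟨fun x => ((Encodable.decode (α := β) x.2.unpair.1).map
    (fun b => r ((x.1, b), x.2.unpair.2))).getD false, ?_, fun a => ?_⟩
  · refine Primrec.option_getD.comp (Primrec.option_map
      (Primrec.decode.comp (Primrec.fst.comp hu)) ?_) (Primrec.const false)
    refine hr.comp ((Primrec.pair (Primrec.fst.comp Primrec.fst) Primrec.snd).pair ?_)
    exact Primrec.snd.comp (hu.comp Primrec.fst)
  · constructor
    · rintro ⟨b, hb⟩
      obtain ⟨s, hs⟩ := (h _).1 hb
      exact ⟨Nat.pair (Encodable.encode b) s, by simp [hs]⟩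
    · rintro ⟨s, hs⟩
      cases hd : (Encodable.decode (α := β) s.unpair.1) with
      | none => simp [hd] at hs
      | some b => 
        simp only [hd, Option.map_some, Option.getD_some] at hs
        exact ⟨b, (h _).2 ⟨_, hs⟩⟩

theorem Sig.all_list {p : β × α → Prop} (hp : Sig p) :
    Sig (fun x : List β × α => ∀ b ∈ x.1, p (b, x.2)) := by
  obtain ⟨r, hr, h⟩ := hp
  have h1 : PrimrecRel (fun (s : ℕ) (y : β × α) => r (y, s) = true) :=
    Primrec.eq.comp (hr.comp (Primrec.snd.pair Primrec.fst)) (Primrec.const true)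
  have h2 := h1.exists_mem_list
  have h3 : PrimrecRel (fun (b : β) (y : α × ℕ) => ∃ s ∈ List.range y.2, r ((b, y.1), s) = true) :=
    h2.comp (Primrec.list_range.comp (Primrec.snd.comp Primrec.snd))
      (Primrec.fst.pair (Primrec.fst.comp Primrec.snd))
  have h4 := h3.forall_mem_list
  have h5 : PrimrecPred (fun y : (List β × α) × ℕ => ∀ b ∈ y.1.1, ∃ s ∈ List.range y.2, r ((b, y.1.2), s) = true) :=
    h4.comp (Primrec.fst.comp Primrec.fst) ((Primrec.snd.comp Primrec.fst).pair Primrec.snd)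
  obtain ⟨hd, h5⟩ := h5
  refine ⟨_, h5, fun a => ?_⟩
  simp only [decide_eq_true_eq, List.mem_range]
  constructor
  · intro hh
    have : ∀ b, ∃ s, b ∈ a.1 → r ((b, a.2), s) = true := by
      intro b
      by_cases hb : b ∈ a.1
      · obtain ⟨s, hs⟩ := (h _).1 (hh b hb)
        exact ⟨s, fun _ => hs⟩
      · exact ⟨0, fun h => absurd h hb⟩
    choose f hf using this
    refine ⟨((a.1.map f).foldr max 0) + 1, fun b hb => ⟨f b, ?_, hf b hb⟩⟩
    have key : ∀ l : List ℕ, ∀ x ∈ l, x ≤ l.foldr max 0 := by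
      intro l
      induction l with
      | nil => simp
      | cons y l ih =>
        intro x hx
        rcases List.mem_cons.1 hx with rfl | hx
        · simp
        · have := ih x hx
          simp only [List.foldr_cons]
          omega
    have := key (a.1.map f) (f b) (List.mem_map_of_mem hb)
    omega
  · rintro ⟨N, hN⟩ b hb
    obtain ⟨s, -, hs⟩ := hN b hb
    exact (h _).2 ⟨s, hs⟩

end SigLemmas

theorem prim_testBit : PrimrecRel (fun u m : ℕ => Nat.testBit u m = true) := by
  have hpow : Primrec (fun m : ℕ => 2 ^ m) := by
    have := Primrec.nat_rec₁ (f := fun _ r => 2 * r) 1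
      (Primrec.nat_mul.comp (Primrec.const 2) Primrec.snd)
    refine this.of_eq fun n => ?_
    induction n with
    | zero => rfl
    | succ n ih => simp only [pow_succ]; rw [← ih]; simp [mul_comm]
  have : PrimrecPred (fun p : ℕ × ℕ => (p.1 / 2 ^ p.2) % 2 = 1) :=
    Primrec.eq.comp (Primrec.nat_mod.comp
      (Primrec.nat_div.comp Primrec.fst (hpow.comp Primrec.snd)) (Primrec.const 2)) (Primrec.const 1)
  refine PrimrecPred.of_eq this fun p => ?_
  simp [Nat.testBit_eq_decide_div_mod_eq]

theorem sig_ceSet : Sig (fun p : ℕ × ℕ => p.2 ∈ ceSet p.1) := by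
  refine ⟨fun x => (Nat.Partrec.Code.evaln x.2
    (Denumerable.ofNat Nat.Partrec.Code x.1.1) x.1.2).isSome, ?_, ?_⟩
  · refine Primrec.option_isSome.comp (Nat.Partrec.Code.primrec_evaln.comp
      ((Primrec.snd.pair ?_).pair (Primrec.snd.comp Primrec.fst)))
    exact (Primrec.ofNat Nat.Partrec.Code).comp (Primrec.fst.comp Primrec.fst)
  · intro a
    simp only [ceSet, Set.mem_ofPred_eq, Part.dom_iff_mem, Option.isSome_iff_exists]
    constructor
    · rintro ⟨y, hy⟩
      obtain ⟨k, hk⟩ := Nat.Partrec.Code.evaln_complete.1 hy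
      exact ⟨k, y, hk⟩
    · rintro ⟨s, y, hy⟩
      exact ⟨y, Nat.Partrec.Code.evaln_sound hy⟩

/-- s-m-n form: semidecidable relations are uniformly c.e. -/
theorem Sig.smn {p : ℕ × ℕ → Prop} (hp : Sig p) :
    ∃ c : ℕ → ℕ, Primrec c ∧ ∀ k x, x ∈ ceSet (c k) ↔ p (k, x) := by
  obtain ⟨q, hq, h⟩ := hp
  have h1 : Partrec (fun z : ℕ => Nat.rfind (fun s => Part.some (q (z.unpair, s)))) :=
    Partrec.rfind ((hq.comp ((Primrec.unpair.comp Primrec.fst).pair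
      Primrec.snd)).to_comp.partrec.to₂)
  obtain ⟨C, hC⟩ := Nat.Partrec.Code.exists_code.1 (Partrec.nat_iff.1 h1)
  refine ⟨fun k => Encodable.encode (Nat.Partrec.Code.curry C k),
    Primrec.encode.comp (Nat.Partrec.Code.primrec₂_curry.comp (Primrec.const C) Primrec.id), ?_⟩
  intro k x
  simp only [ceSet, Set.mem_ofPred_eq, Denumerable.ofNat_encode, Nat.Partrec.Code.eval_curry, hC, h,
    Nat.unpair_pair]
  refine Nat.rfind_dom.trans ?_
  simp only [Part.mem_some_iff]
  constructor
  · rintro ⟨s, hs, -⟩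
    exact ⟨s, hs.symm⟩
  · rintro ⟨s, hs⟩
    exact ⟨s, hs.symm, fun _ => trivial⟩

theorem exists_finCode (l : List ℕ) : ∃ u, ∀ m, m ∈ finCode u ↔ m ∈ l := by
  refine ⟨∑ i ∈ l.toFinset, 2 ^ i, fun m => ?_⟩
  have h := Finset.toFinset_bitIndices_sum_two_pow l.toFinset
  have h2 : m ∈ (∑ i ∈ l.toFinset, 2 ^ i).bitIndices.toFinset ↔ m ∈ l.toFinset := by rw [h]
  rw [List.mem_toFinset, List.mem_toFinset, Nat.mem_bitIndices] at h2
  exact h2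

theorem lt_of_mem_finCode {u m : ℕ} (h : m ∈ finCode u) : m < u := by
  have := Nat.ge_two_pow_of_testBit h
  exact lt_of_lt_of_le Nat.lt_two_pow_self this

/-- list version of the enumeration operators -/
def RL (p : ℕ × ℕ × List ℕ) : Prop :=
  ∃ u, Nat.pair p.2.1 u ∈ ceSet p.1 ∧ ∀ m ∈ List.range u, ¬ Nat.testBit u m = true ∨ m ∈ p.2.2

theorem prim_mem : PrimrecRel (fun (m : ℕ) (l : List ℕ) => m ∈ l) := by
  have h : PrimrecRel (fun (l : List ℕ) (m : ℕ) => ∃ a ∈ l, a = m) :=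
    (Primrec.eq (α := ℕ)).exists_mem_list
  refine PrimrecPred.of_eq (h.comp Primrec.snd Primrec.fst) fun p => by simp

theorem sig_RL : Sig RL := by
  refine Sig.ex (p := fun x : (ℕ × ℕ × List ℕ) × ℕ => Nat.pair x.1.2.1 x.2 ∈ ceSet x.1.1 ∧
    ∀ m ∈ List.range x.2, ¬ Nat.testBit x.2 m = true ∨ m ∈ x.1.2.2) (Sig.and ?_ ?_)
  · refine sig_ceSet.comp (f := fun x : (ℕ × ℕ × List ℕ) × ℕ => (x.1.1, Nat.pair x.1.2.1 x.2)) ?_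
    exact (Primrec.fst.comp Primrec.fst).pair (Primrec₂.natPair.comp
      (Primrec.fst.comp (Primrec.snd.comp Primrec.fst)) Primrec.snd)
  · refine Sig.of_prim ?_
    have h : PrimrecRel (fun (m : ℕ) (x : ℕ × List ℕ) => ¬ Nat.testBit x.1 m = true ∨ m ∈ x.2) :=
      (PrimrecPred.not (prim_testBit.comp (Primrec.fst.comp Primrec.snd) Primrec.fst)).or
        (prim_mem.comp Primrec.fst (Primrec.snd.comp Primrec.snd))
    exact h.forall_mem_list.comp (Primrec.list_range.comp Primrec.snd)
      (Primrec.snd.pair (Primrec.snd.comp (Primrec.snd.comp Primrec.fst)))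

theorem mem_eOp_iff {i n : ℕ} {B : Set ℕ} :
    n ∈ eOp i B ↔ ∃ l, RL (i, n, l) ∧ ∀ m ∈ l, m ∈ B := by
  constructor
  · rintro ⟨u, hu, hB⟩
    refine ⟨u.bitIndices, ⟨u, hu, fun m _ => ?_⟩, fun m hm => hB (by simpa [finCode] using hm)⟩
    by_cases h : Nat.testBit u m = true
    · right; simpa using h
    · left; exact h
  · rintro ⟨l, ⟨u, hu, hl⟩, hB⟩
    refine ⟨u, hu, fun m hm => hB m ?_⟩
    rcases hl m (List.mem_range.2 (lt_of_mem_finCode hm)) with h | h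
    · exact absurd hm h
    · exact h

theorem eOp_mono {i : ℕ} {A B : Set ℕ} (h : A ⊆ B) : eOp i A ⊆ eOp i B := by
  rintro n ⟨u, hu, hA⟩
  exact ⟨u, hu, hA.trans h⟩

theorem Sig.eOp {R : ℕ × ℕ × List ℕ → Prop} (hR : Sig R) :
    ∃ c : ℕ → ℕ, Primrec c ∧ ∀ k B, eOp (c k) B = {n | ∃ l, R (k, n, l) ∧ ∀ m ∈ l, m ∈ B} := by
  have h1 : Sig (fun p : ℕ × ℕ => ∃ l : List ℕ, R (p.1, p.2.unpair.1, l) ∧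
      ∀ m ∈ l, Nat.testBit p.2.unpair.2 m = true) := by
    have hu := Primrec.unpair.comp (Primrec.snd.comp (Primrec.fst (α := ℕ × ℕ) (β := List ℕ)))
    refine Sig.ex (p := fun x : (ℕ × ℕ) × List ℕ => R (x.1.1, x.1.2.unpair.1, x.2) ∧
      ∀ m ∈ x.2, Nat.testBit x.1.2.unpair.2 m = true) (Sig.and ?_ (Sig.of_prim ?_))
    · exact hR.comp (f := fun x : (ℕ × ℕ) × List ℕ => (x.1.1, x.1.2.unpair.1, x.2))
        ((Primrec.fst.comp Primrec.fst).pair ((Primrec.fst.comp hu).pair Primrec.snd))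
    · have h0 : PrimrecRel fun (m u : ℕ) => Nat.testBit u m = true :=
        prim_testBit.comp Primrec.snd Primrec.fst
      exact h0.forall_mem_list.comp Primrec.snd (Primrec.snd.comp hu)
  obtain ⟨c, hc, h⟩ := h1.smn
  refine ⟨c, hc, fun k B => ?_⟩
  ext n
  simp only [_root_.eOp, Set.mem_ofPred_eq, h, Nat.unpair_pair]
  constructor
  · rintro ⟨u, ⟨l, hl, hu⟩, hB⟩
    exact ⟨l, hl, fun m hm => hB (hu m hm)⟩
  · rintro ⟨l, hl, hB⟩
    obtain ⟨u, hu⟩ := exists_finCode l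
    exact ⟨u, ⟨l, hl, fun m hm => (hu m).2 hm⟩, fun m hm => hB m ((hu m).1 hm)⟩

theorem eLe_of_sig {R : ℕ × List ℕ → Prop} (hR : Sig R) {A B : Set ℕ}
    (h : ∀ n, n ∈ A ↔ ∃ l, R (n, l) ∧ ∀ m ∈ l, m ∈ B) : ELe A B := by
  obtain ⟨c, -, hc⟩ := Sig.eOp (R := fun x => R x.2) (hR.comp Primrec.snd)
  refine ⟨c 0, ?_⟩
  rw [ELeVia, hc]
  ext n
  exact h n

theorem comp_index (i : ℕ) : ∃ c : ℕ → ℕ, Primrec c ∧ ∀ k B, eOp (c k) B = eOp k (eOp i B) := by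
  have h : Sig (fun x : ℕ × ℕ × List ℕ => ∃ l : List ℕ, RL (x.1, x.2.1, l) ∧
      ∀ m ∈ l, ∃ l' : List ℕ, RL (i, m, l') ∧ ∀ y ∈ l', y ∈ x.2.2) := by
    refine Sig.ex (p := fun z : (ℕ × ℕ × List ℕ) × List ℕ => RL (z.1.1, z.1.2.1, z.2) ∧
      ∀ m ∈ z.2, ∃ l' : List ℕ, RL (i, m, l') ∧ ∀ y ∈ l', y ∈ z.1.2.2) (Sig.and ?_ ?_)
    · exact sig_RL.comp (f := fun z : (ℕ × ℕ × List ℕ) × List ℕ => (z.1.1, z.1.2.1, z.2))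
        ((Primrec.fst.comp Primrec.fst).pair
        ((Primrec.fst.comp (Primrec.snd.comp Primrec.fst)).pair Primrec.snd))
    · have h1 : Sig (fun y : ℕ × List ℕ => ∃ l' : List ℕ, RL (i, y.1, l') ∧ ∀ z ∈ l', z ∈ y.2) := by
        refine Sig.ex (p := fun w : (ℕ × List ℕ) × List ℕ => RL (i, w.1.1, w.2) ∧
          ∀ z ∈ w.2, z ∈ w.1.2) (Sig.and ?_ (Sig.of_prim ?_))
        · exact sig_RL.comp (f := fun w : (ℕ × List ℕ) × List ℕ => (i, w.1.1, w.2))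
            ((Primrec.const i).pair ((Primrec.fst.comp Primrec.fst).pair Primrec.snd))
        · exact prim_mem.forall_mem_list.comp Primrec.snd (Primrec.snd.comp Primrec.fst)
      exact h1.all_list.comp (f := fun z : (ℕ × ℕ × List ℕ) × List ℕ => (z.2, z.1.2.2))
        (Primrec.snd.pair (Primrec.snd.comp (Primrec.snd.comp Primrec.fst)))
  obtain ⟨c, hc, h⟩ := h.eOp
  refine ⟨c, hc, fun k B => ?_⟩
  rw [h]
  ext n
  simp only [Set.mem_ofPred_eq, mem_eOp_iff (i := k)]
  constructor
  · rintro ⟨L, ⟨l, hl, hL⟩, hB⟩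
    refine ⟨l, hl, fun m hm => ?_⟩
    obtain ⟨l', h1, h2⟩ := hL m hm
    exact mem_eOp_iff.2 ⟨l', h1, fun y hy => hB y (h2 y hy)⟩
  · rintro ⟨l, hl, hB⟩
    have : ∀ m, ∃ l', m ∈ l → RL (i, m, l') ∧ ∀ y ∈ l', y ∈ B := by
      intro m
      by_cases hm : m ∈ l
      · obtain ⟨l', hl'⟩ := mem_eOp_iff.1 (hB m hm)
        exact ⟨l', fun _ => hl'⟩
      · exact ⟨[], fun h => absurd h hm⟩
    choose g hg using this
    refine ⟨l.flatMap g, ⟨l, hl, fun m hm => ⟨g m, (hg m hm).1, fun y hy => ?_⟩⟩, ?_⟩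
    · exact List.mem_flatMap.2 ⟨m, hm, hy⟩
    · intro y hy
      obtain ⟨m, hm, hy⟩ := List.mem_flatMap.1 hy
      exact (hg m hm).2 y hy

theorem ELe.trans {A B C : Set ℕ} (h : ELe A B) (h' : ELe B C) : ELe A C := by
  obtain ⟨i, rfl⟩ := h
  obtain ⟨j, rfl⟩ := h'
  obtain ⟨c, -, hc⟩ := comp_index j
  exact ⟨c i, (hc i C).symm⟩

/-- many-one reductions -/
theorem eLe_of_map {A B : Set ℕ} {f : ℕ → ℕ} (hf : Primrec f) (h : ∀ n, n ∈ A ↔ f n ∈ B) :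
    ELe A B := by
  refine eLe_of_sig (R := fun x => f x.1 ∈ x.2)
    (Sig.of_prim (prim_mem.comp (hf.comp Primrec.fst) Primrec.snd)) fun n => ?_
  rw [h]
  exact ⟨fun h => ⟨[f n], by simpa using h⟩, fun ⟨l, h1, h2⟩ => h2 _ h1⟩

theorem ELe.refl (A : Set ℕ) : ELe A A := eLe_of_map Primrec.id fun _ => Iff.rfl

theorem isCE_of_eLe_empty {A : Set ℕ} (h : ELe A ∅) : IsCE A := by
  obtain ⟨i, rfl⟩ := h
  have h1 : Sig (fun p : ℕ × ℕ => RL (i, p.2, [])) :=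
    sig_RL.comp (f := fun p : ℕ × ℕ => (i, p.2, ([] : List ℕ)))
      ((Primrec.const i).pair (Primrec.snd.pair (Primrec.const [])))
  obtain ⟨c, -, hc⟩ := h1.smn
  refine ⟨c 0, ?_⟩
  ext n
  rw [hc, mem_eOp_iff]
  constructor
  · rintro ⟨l, hl, h⟩
    have : l = [] := List.eq_nil_iff_forall_not_mem.2 h
    rwa [this] at hl
  · intro h
    exact ⟨[], h, by simp⟩

theorem empty_eLe (A : Set ℕ) : ELe ∅ A := 
  eLe_of_sig (R := fun _ => (0 : ℕ) = 1) (Sig.of_prim (Primrec.eq.comp (Primrec.const 0)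
    (Primrec.const 1))) (by simp)

/-! ## Joins, columns, finite sets -/

theorem mem_eJoin_even {A B : Set ℕ} {m : ℕ} : 2 * m ∈ eJoin A B ↔ m ∈ A := by
  constructor
  · rintro (⟨k, hk, h⟩ | ⟨k, hk, h⟩)
    · have : m = k := by omega
      rwa [this]
    · omega
  · intro h
    exact Or.inl ⟨m, h, rfl⟩

theorem mem_eJoin_odd {A B : Set ℕ} {m : ℕ} : 2 * m + 1 ∈ eJoin A B ↔ m ∈ B := by
  constructor
  · rintro (⟨k, hk, h⟩ | ⟨k, hk, h⟩)
    · omega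
    · have : m = k := by omega
      rwa [this]
  · intro h
    exact Or.inr ⟨m, h, rfl⟩

theorem mem_eJoin_iff {A B : Set ℕ} {n : ℕ} :
    n ∈ eJoin A B ↔ (n % 2 = 0 ∧ n / 2 ∈ A) ∨ (n % 2 = 1 ∧ n / 2 ∈ B) := by
  rcases Nat.mod_two_eq_zero_or_one n with h | h
  · have : n = 2 * (n / 2) := by omega
    conv_lhs => rw [this, mem_eJoin_even]
    simp [h]
  · have : n = 2 * (n / 2) + 1 := by omega
    conv_lhs => rw [this, mem_eJoin_odd]
    simp [h]

theorem prim_double : Primrec (fun n : ℕ => 2 * n) :=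
  Primrec.nat_mul.comp (Primrec.const 2) Primrec.id

theorem prim_half : Primrec (fun n : ℕ => n / 2) :=
  Primrec.nat_div.comp Primrec.id (Primrec.const 2)

theorem prim_even : PrimrecPred (fun n : ℕ => n % 2 = 0) :=
  Primrec.eq.comp (Primrec.nat_mod.comp Primrec.id (Primrec.const 2)) (Primrec.const 0)

theorem eLe_join_left (A B : Set ℕ) : ELe A (eJoin A B) :=
  eLe_of_map prim_double fun _ => mem_eJoin_even.symm

theorem eLe_join_right (A B : Set ℕ) : ELe B (eJoin A B) :=
  eLe_of_map (Primrec.succ.comp prim_double) fun _ => mem_eJoin_odd.symm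

theorem eJoin_eLe {A B C : Set ℕ} (hA : ELe A C) (hB : ELe B C) : ELe (eJoin A B) C := by
  obtain ⟨i, rfl⟩ := hA
  obtain ⟨j, rfl⟩ := hB
  refine eLe_of_sig (R := fun x => RL (if x.1 % 2 = 0 then i else j, x.1 / 2, x.2)) ?_ fun n => ?_
  · refine sig_RL.comp (f := fun x : ℕ × List ℕ => (if x.1 % 2 = 0 then i else j, x.1 / 2, x.2)) ?_
    refine Primrec.pair ?_ ((prim_half.comp Primrec.fst).pair Primrec.snd)
    exact Primrec.ite (prim_even.comp Primrec.fst) (Primrec.const i) (Primrec.const j)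
  · rw [mem_eJoin_iff]
    rcases Nat.mod_two_eq_zero_or_one n with h | h
    · simp [h, mem_eOp_iff]
    · simp [h, mem_eOp_iff]

theorem union_eLe {A B C : Set ℕ} (hA : ELe A C) (hB : ELe B C) : ELe (A ∪ B) C := by
  refine ELe.trans ?_ (eJoin_eLe hA hB)
  refine eLe_of_sig (R := fun x => 2 * x.1 ∈ x.2 ∨ 2 * x.1 + 1 ∈ x.2) (Sig.of_prim ?_) fun n => ?_
  · exact (prim_mem.comp (prim_double.comp Primrec.fst) Primrec.snd).or
      (prim_mem.comp (Primrec.succ.comp (prim_double.comp Primrec.fst)) Primrec.snd)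
  · constructor
    · rintro (h | h)
      · exact ⟨[2 * n], by simp, by simpa using mem_eJoin_even.2 h⟩
      · exact ⟨[2 * n + 1], by simp, by simpa using mem_eJoin_odd.2 h⟩
    · rintro ⟨l, h1 | h1, h⟩
      · exact Or.inl (mem_eJoin_even.1 (h _ h1))
      · exact Or.inr (mem_eJoin_odd.1 (h _ h1))

/-- put `D` on column `c` -/
def colSet (c : ℕ) (D : Set ℕ) : Set ℕ := {x | x.unpair.1 = c ∧ x.unpair.2 ∈ D}

/-- the part of the `n`-th finite set on columns `≥ s` -/
def finAbove (n s : ℕ) : Set ℕ := {x | x ∈ finCode n ∧ s ≤ x.unpair.1}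

/-- all columns `≥ s` -/
def above (s : ℕ) : Set ℕ := {x | s ≤ x.unpair.1}

theorem eLe_of_prim {A B : Set ℕ} (h : PrimrecPred (fun x => x ∈ A)) : ELe A B :=
  eLe_of_sig (R := fun x => x.1 ∈ A) (Sig.of_prim (h.comp Primrec.fst)) fun n =>
    ⟨fun h => ⟨[], h, by simp⟩, fun ⟨_, h, _⟩ => h⟩

theorem prim_above (s : ℕ) : PrimrecPred (fun x => x ∈ above s) :=
  Primrec.nat_le.comp (Primrec.const s) (Primrec.fst.comp Primrec.unpair)

theorem above_eLe (s : ℕ) (B : Set ℕ) : ELe (above s) B := eLe_of_prim (prim_above s)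

theorem finAbove_eLe (n s : ℕ) (B : Set ℕ) : ELe (finAbove n s) B :=
  eLe_of_prim ((prim_testBit.comp (Primrec.const n) Primrec.id).and (prim_above s))

theorem colSet_eLe (c : ℕ) (D : Set ℕ) : ELe (colSet c D) D := by
  refine eLe_of_sig (R := fun x => x.1.unpair.1 = c ∧ x.1.unpair.2 ∈ x.2) (Sig.of_prim ?_)
    fun n => ?_
  · have hu := Primrec.unpair.comp (Primrec.fst (α := ℕ) (β := List ℕ))
    exact (Primrec.eq.comp (Primrec.fst.comp hu) (Primrec.const c)).and
      (prim_mem.comp (Primrec.snd.comp hu) Primrec.snd)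
  · constructor
    · rintro ⟨h1, h2⟩
      exact ⟨[n.unpair.2], ⟨h1, by simp⟩, by simpa using h2⟩
    · rintro ⟨l, ⟨h1, h2⟩, h⟩
      exact ⟨h1, h _ h2⟩

theorem section_eLe (c : ℕ) (Z : Set ℕ) : ELe {m | Nat.pair c m ∈ Z} Z :=
  eLe_of_map (f := fun m => Nat.pair c m) (Primrec₂.natPair.comp (Primrec.const c) Primrec.id)
    fun _ => Iff.rfl

theorem compl_join_eLe (A : Set ℕ) : ELe (eJoin A Aᶜ)ᶜ (eJoin A Aᶜ) := by
  refine eLe_of_map (f := fun n => if n % 2 = 0 then n + 1 else n - 1) ?_ fun n => ?_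
  · exact Primrec.ite prim_even Primrec.succ Primrec.pred
  · rcases Nat.mod_two_eq_zero_or_one n with h | h
    · obtain ⟨m, rfl⟩ : ∃ m, n = 2 * m := ⟨n / 2, by omega⟩
      rw [if_pos h, mem_eJoin_odd, Set.mem_compl_iff, mem_eJoin_even, Set.mem_compl_iff]
    · obtain ⟨m, rfl⟩ : ∃ m, n = 2 * m + 1 := ⟨n / 2, by omega⟩
      rw [if_neg (by omega), Nat.add_sub_cancel, mem_eJoin_even, Set.mem_compl_iff, mem_eJoin_odd,
        Set.mem_compl_iff, not_not]

/-! ## Finitary operators and the generic construction -/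

def opG (W : Set ℕ) (i : ℕ) (A : Set ℕ) : Set ℕ := eOp i (eJoin W A)

def opD (b : ℕ) (W V : Set ℕ) (j : ℕ) (A : Set ℕ) : Set ℕ :=
  if b = 0 then opG W j A else Vᶜ

def Finitary (Φ : Set ℕ → Set ℕ) : Prop :=
  ∀ A x, x ∈ Φ A → ∃ l : List ℕ, (∀ m ∈ l, m ∈ A) ∧ ∀ B : Set ℕ, (∀ m ∈ l, m ∈ B) → x ∈ Φ B

theorem Finitary.mono {Φ : Set ℕ → Set ℕ} (h : Finitary Φ) {A B : Set ℕ} (hAB : A ⊆ B) :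
    Φ A ⊆ Φ B := by
  intro x hx
  obtain ⟨l, h1, h2⟩ := h A x hx
  exact h2 B fun m hm => hAB (h1 m hm)

theorem finitary_opG (W : Set ℕ) (i : ℕ) : Finitary (opG W i) := by
  intro A x hx
  obtain ⟨l, hl, h⟩ := mem_eOp_iff.1 hx
  refine ⟨(l.filter (fun n => n % 2 = 1)).map (fun n => n / 2), ?_, ?_⟩
  · intro m hm
    simp only [List.mem_map, List.mem_filter, decide_eq_true_eq] at hm
    obtain ⟨y, ⟨hy, hy1⟩, rfl⟩ := hm
    rcases mem_eJoin_iff.1 (h y hy) with h' | h'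
    · omega
    · exact h'.2
  · intro B hB
    refine mem_eOp_iff.2 ⟨l, hl, fun y hy => mem_eJoin_iff.2 ?_⟩
    rcases mem_eJoin_iff.1 (h y hy) with h' | h'
    · exact Or.inl h'
    · refine Or.inr ⟨h'.1, hB _ ?_⟩
      simp only [List.mem_map, List.mem_filter, decide_eq_true_eq]
      exact ⟨y, ⟨hy, h'.1⟩, rfl⟩

theorem finitary_opD (b : ℕ) (W V : Set ℕ) (j : ℕ) : Finitary (opD b W V j) := by
  by_cases hb : b = 0
  · have : opD b W V j = opG W j := by funext A; simp [opD, hb]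
    rw [this]
    exact finitary_opG W j
  · intro A x hx
    exact ⟨[], by simp, fun B _ => by simpa [opD, hb] using hx⟩

theorem no_hit {Γ Δ : Set ℕ → Set ℕ} (hΓ : Finitary Γ) (hΔ : Finitary Δ) {P Z : Set ℕ} {s : ℕ}
    (hZ : Z ⊆ P ∪ above s)
    (hno : ∀ n, ¬ ∃ x, x ∈ Γ (P ∪ finAbove n s) ∧ x ∈ Δ (P ∪ finAbove n s))
    (hc : (Γ Z)ᶜ = Δ Z) : Γ Z = Γ (P ∪ above s) := by
  apply Set.Subset.antisymm (hΓ.mono hZ)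
  intro x hx
  by_contra hxZ
  have hxD : x ∈ Δ (P ∪ above s) := hΔ.mono hZ (hc ▸ hxZ)
  obtain ⟨l, h1, h2⟩ := hΓ _ _ hx
  obtain ⟨l', h1', h2'⟩ := hΔ _ _ hxD
  obtain ⟨u, hu⟩ := exists_finCode (l ++ l')
  refine hno u ⟨x, h2 _ fun m hm => ?_, h2' _ fun m hm => ?_⟩
  · rcases h1 m hm with h | h
    · exact Or.inl h
    · exact Or.inr ⟨(hu m).2 (by simp [hm]), h⟩
  · rcases h1' m hm with h | h
    · exact Or.inl h
    · exact Or.inr ⟨(hu m).2 (by simp [hm]), h⟩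

abbrev ReqIx : Type := ℕ × ℕ × ℕ × ℕ

/-- the requirement with index `q` is met by a positive witness -/
def HitQ (W V : ℕ → Set ℕ) (q : ReqIx) (A : Set ℕ) : Prop :=
  ∃ x, x ∈ opG (W q.2.1) q.2.2.1 A ∧ x ∈ opD q.1 (W q.2.1) (V q.2.2.2) q.2.2.2 A

def Hit (W V : ℕ → Set ℕ) (t : ℕ) (A : Set ℕ) : Prop := HitQ W V (Denumerable.ofNat ReqIx t) A

theorem Hit.mono {W V : ℕ → Set ℕ} {t : ℕ} {A B : Set ℕ} (hAB : A ⊆ B) (h : Hit W V t A) :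
    Hit W V t B := by
  obtain ⟨x, h1, h2⟩ := h
  exact ⟨x, (finitary_opG _ _).mono hAB h1, (finitary_opD _ _ _ _).mono hAB h2⟩

def pickP (W V : ℕ → Set ℕ) (t : ℕ) (P : Set ℕ) (s n : ℕ) : Prop :=
  Hit W V t (P ∪ finAbove n s) ∨ ∀ m, ¬ Hit W V t (P ∪ finAbove m s)

theorem pickP_ex (W V : ℕ → Set ℕ) (t : ℕ) (P : Set ℕ) (s : ℕ) : ∃ n, pickP W V t P s n := by
  by_cases h : ∃ n, Hit W V t (P ∪ finAbove n s)
  · obtain ⟨n, hn⟩ := h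
    exact ⟨n, Or.inl hn⟩
  · exact ⟨0, Or.inr fun m hm => h ⟨m, hm⟩⟩

noncomputable def pick (W V : ℕ → Set ℕ) (t : ℕ) (P : Set ℕ) (s : ℕ) : ℕ :=
  Nat.find (pickP_ex W V t P s)

noncomputable def gen (W V D : ℕ → Set ℕ) : ℕ → Set ℕ × ℕ
  | 0 => (∅, 0)
  | t + 1 =>
    ((gen W V D t).1 ∪ finAbove (pick W V t (gen W V D t).1 (gen W V D t).2) (gen W V D t).2 ∪
      colSet ((gen W V D t).2 + pick W V t (gen W V D t).1 (gen W V D t).2 + 1) (D t),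
     (gen W V D t).2 + pick W V t (gen W V D t).1 (gen W V D t).2 + 2)

noncomputable def genSet (W V D : ℕ → Set ℕ) : Set ℕ := {x | ∃ t, x ∈ (gen W V D t).1}

section genLemmas
variable (W V D : ℕ → Set ℕ)

theorem gen_mono_one (t : ℕ) : (gen W V D t).1 ⊆ (gen W V D (t + 1)).1 :=
  fun _ hx => Or.inl (Or.inl hx)

theorem gen_snd_lt (t : ℕ) : (gen W V D t).2 < (gen W V D (t + 1)).2 := by
  simp only [gen]
  omega

theorem gen_snd_mono {t t' : ℕ} (h : t ≤ t') : (gen W V D t).2 ≤ (gen W V D t').2 :=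
  (strictMono_nat_of_lt_succ (gen_snd_lt W V D)).monotone h

theorem gen_bound (t : ℕ) : ∀ x ∈ (gen W V D t).1, x.unpair.1 < (gen W V D t).2 := by
  induction t with
  | zero => intro x hx; exact absurd hx (by simp [gen])
  | succ t ih =>
    rintro x ((hx | hx) | hx)
    · exact lt_trans (ih x hx) (gen_snd_lt W V D t)
    · have h1 := lt_of_mem_finCode hx.1
      have h2 := Nat.unpair_left_le x
      simp only [gen]
      omega
    · have := hx.1
      simp only [gen]
      omega

theorem gen_new (t : ℕ) : ∀ x ∈ (gen W V D (t + 1)).1, x ∉ (gen W V D t).1 →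
    (gen W V D t).2 ≤ x.unpair.1 := by
  rintro x ((hx | hx) | hx) h
  · exact absurd hx h
  · exact hx.2
  · have := hx.1
    omega

theorem gen_new' (t t' : ℕ) (h : t ≤ t') : (gen W V D t').1 ⊆ (gen W V D t).1 ∪ above (gen W V D t).2 := by
  induction t', h using Nat.le_induction with
  | base => exact Set.subset_union_left
  | succ t' ht ih =>
    intro x hx
    by_cases h : x ∈ (gen W V D t').1
    · exact ih h
    · exact Or.inr (le_trans (gen_snd_mono W V D ht) (gen_new W V D t' x hx h))

theorem genSet_sub (t : ℕ) : genSet W V D ⊆ (gen W V D t).1 ∪ above (gen W V D t).2 := by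
  rintro x ⟨t', hx⟩
  rcases le_total t t' with h | h
  · exact gen_new' W V D t t' h hx
  · exact Or.inl (monotone_nat_of_le_succ (f := fun t => (gen W V D t).1)
      (gen_mono_one W V D) h hx)

theorem gen_sub (t : ℕ) : (gen W V D t).1 ⊆ genSet W V D := fun _ hx => ⟨t, hx⟩

/-- column of `D t` -/
theorem genSet_col (t : ℕ) (m : ℕ) :
    Nat.pair ((gen W V D t).2 + pick W V t (gen W V D t).1 (gen W V D t).2 + 1) m ∈ genSet W V D
      ↔ m ∈ D t := by
  constructor
  · intro h
    rcases genSet_sub W V D (t + 1) h with ((h | h) | h) | h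
    · have := gen_bound W V D t _ h
      simp only [Nat.unpair_pair] at this
      omega
    · have h1 := lt_of_mem_finCode h.1
      have h2 := Nat.left_le_pair ((gen W V D t).2 + pick W V t (gen W V D t).1 (gen W V D t).2 + 1) m
      omega
    · simpa using h.2
    · simp only [above, gen, Set.mem_ofPred_eq, Nat.unpair_pair] at h
      omega
  · intro h
    exact gen_sub W V D (t + 1) (Or.inr ⟨by simp, by simpa using h⟩)

theorem D_eLe_genSet (t : ℕ) : ELe (D t) (genSet W V D) := by
  have h := section_eLe ((gen W V D t).2 + pick W V t (gen W V D t).1 (gen W V D t).2 + 1)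
    (genSet W V D)
  have h2 : {m | Nat.pair ((gen W V D t).2 + pick W V t (gen W V D t).1 (gen W V D t).2 + 1) m
      ∈ genSet W V D} = D t := by
    ext m
    exact genSet_col W V D t m
  rwa [h2] at h

theorem gen_eLe (hD : ∀ t, ELe (D t) (D (t + 1))) (t : ℕ) : ELe (gen W V D t).1 (D t) := by
  induction t with
  | zero => exact empty_eLe _
  | succ t ih =>
    exact (union_eLe (union_eLe ih (finAbove_eLe _ _ _)) (colSet_eLe _ _)).trans (hD t)

theorem genSet_req (q : ReqIx)
    (hc : (opG (W q.2.1) q.2.2.1 (genSet W V D))ᶜ =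
      opD q.1 (W q.2.1) (V q.2.2.2) q.2.2.2 (genSet W V D)) :
    ∃ t, opG (W q.2.1) q.2.2.1 (genSet W V D) =
      opG (W q.2.1) q.2.2.1 ((gen W V D t).1 ∪ above (gen W V D t).2) := by
  refine ⟨Encodable.encode q, ?_⟩
  set t := Encodable.encode q with ht
  have hq : Denumerable.ofNat ReqIx t = q := Denumerable.ofNat_encode q
  refine no_hit (finitary_opG _ _) (finitary_opD q.1 (W q.2.1) (V q.2.2.2) q.2.2.2)
    (genSet_sub W V D t) ?_ hc
  have hp : pickP W V t (gen W V D t).1 (gen W V D t).2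
      (pick W V t (gen W V D t).1 (gen W V D t).2) := Nat.find_spec (pickP_ex W V t _ _)
  rcases hp with hp | hp
  · exfalso
    have h1 : Hit W V t (genSet W V D) := by
      refine hp.mono (Set.Subset.trans ?_ (gen_sub W V D (t + 1)))
      exact fun x hx => Or.inl hx
    rw [Hit, hq] at h1
    obtain ⟨x, h2, h3⟩ := h1
    rw [← hc] at h3
    exact h3 h2
  · intro n hn
    apply hp n
    rw [Hit, hq]
    exact hn

theorem opG_above_eLe (U P : Set ℕ) (i s : ℕ) : ELe (opG U i (P ∪ above s)) (eJoin U P) :=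
  ELe.trans ⟨i, rfl⟩ (eJoin_eLe (eLe_join_left _ _)
    (union_eLe (eLe_join_right _ _) (above_eLe _ _)))

theorem genSet_main (hD : ∀ t, ELe (D t) (D (t + 1))) (k : ℕ) (B : Set ℕ)
    (hB : ELe B (eJoin (W k) (genSet W V D))) (h : ELe Bᶜ B ∨ ∃ j, B = V j) :
    ∃ t, ELe B (eJoin (W k) (D t)) := by
  obtain ⟨i, hi⟩ := hB
  have key : ∃ t, opG (W k) i (genSet W V D) =
      opG (W k) i ((gen W V D t).1 ∪ above (gen W V D t).2) := by
    rcases h with h | ⟨j, hj⟩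
    · obtain ⟨j, hj⟩ := h.trans ⟨i, hi⟩
      refine genSet_req W V D (0, k, i, j) ?_
      simp only [opD, if_true]
      have : opG (W k) i (genSet W V D) = B := hi.symm
      rw [this]
      exact hj
    · refine genSet_req W V D (1, k, i, j) ?_
      have : opG (W k) i (genSet W V D) = B := hi.symm
      simp [opD, this, hj]
  obtain ⟨t, ht⟩ := key
  refine ⟨t, ?_⟩
  have : B = opG (W k) i ((gen W V D t).1 ∪ above (gen W V D t).2) := hi.trans ht
  rw [this]
  exact (opG_above_eLe _ _ _ _).trans (eJoin_eLe (eLe_join_left _ _)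
    ((gen_eLe W V D hD t).trans (eLe_join_right _ _)))

theorem genSet_ne (hD : ∀ t, D t = ∅) (j : ℕ) : genSet W V D ≠ V j := by
  intro h
  obtain ⟨i, hi⟩ : ∃ i, ∀ A, opG (W 0) i A = A := by
    obtain ⟨c, -, hc⟩ := Sig.eOp (R := fun x => 2 * x.2.1 + 1 ∈ x.2.2) (Sig.of_prim
      (prim_mem.comp (Primrec.succ.comp (prim_double.comp (Primrec.fst.comp Primrec.snd)))
        (Primrec.snd.comp Primrec.snd)))
    refine ⟨c 0, fun A => ?_⟩
    rw [opG, hc]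
    ext n
    constructor
    · rintro ⟨l, h1, h2⟩
      exact mem_eJoin_odd.1 (h2 _ h1)
    · intro hn
      exact ⟨[2 * n + 1], by simp, by simpa using mem_eJoin_odd.2 hn⟩
  obtain ⟨t, ht⟩ := genSet_req W V D (1, 0, i, j) (by simp [opD, hi, h])
  simp only [hi] at ht
  have h1 := genSet_col W V D t 0
  rw [hD, ht] at h1
  refine absurd (h1.1 (Or.inr ?_)) (by simp)
  simp only [above, Set.mem_ofPred_eq, Nat.unpair_pair]
  omega

end genLemmas


/-! ## Measurability -/

section Meas
variable {Ω : Type} [MeasurableSpace Ω]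

theorem meas_mem {F : Ω → Set ℕ} (hF : Measurable F) (n : ℕ) : Measurable fun ω => n ∈ F ω :=
  measurable_set_iff.1 hF n

theorem meas_eOp {F : Ω → Set ℕ} (hF : Measurable F) (i : ℕ) : Measurable fun ω => eOp i (F ω) := by
  refine measurable_set_iff.2 fun n => ?_
  refine Measurable.exists fun u => Measurable.and measurable_const ?_
  exact Measurable.forall fun m => Measurable.imp measurable_const (meas_mem hF m)

theorem meas_union {F G : Ω → Set ℕ} (hF : Measurable F) (hG : Measurable G) :
    Measurable fun ω => F ω ∪ G ω :=
  measurable_set_iff.2 fun n => (meas_mem hF n).or (meas_mem hG n)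

theorem meas_compl {F : Ω → Set ℕ} (hF : Measurable F) : Measurable fun ω => (F ω)ᶜ :=
  measurable_set_iff.2 fun n => (meas_mem hF n).not

theorem meas_eJoin {F G : Ω → Set ℕ} (hF : Measurable F) (hG : Measurable G) :
    Measurable fun ω => eJoin (F ω) (G ω) :=
  measurable_set_iff.2 fun n =>
    (Measurable.exists fun m => (meas_mem hF m).and measurable_const).or
      (Measurable.exists fun m => (meas_mem hG m).and measurable_const)

theorem meas_ELe {F G : Ω → Set ℕ} (hF : Measurable F) (hG : Measurable G) :
    Measurable fun ω => ELe (F ω) (G ω) := by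
  refine Measurable.exists fun i => ?_
  have : (fun ω => ELeVia (F ω) (G ω) i) = fun ω => ∀ n, n ∈ F ω ↔ n ∈ eOp i (G ω) := by
    funext ω
    exact propext Set.ext_iff
  rw [this]
  exact Measurable.forall fun n => (meas_mem hF n).iff (meas_mem (meas_eOp hG i) n)

theorem meas_Hit {W V : Ω → ℕ → Set ℕ} (hW : ∀ k, Measurable fun ω => W ω k)
    (hV : ∀ k, Measurable fun ω => V ω k) {P : Ω → Set ℕ} (hP : Measurable P) (t : ℕ) :
    Measurable fun ω => Hit (W ω) (V ω) t (P ω) := by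
  unfold Hit HitQ opD opG
  refine Measurable.exists fun x => ?_
  refine (meas_mem (meas_eOp (meas_eJoin (hW _) hP) _) x).and ?_
  split_ifs
  · exact meas_mem (meas_eOp (meas_eJoin (hW _) hP) _) x
  · exact meas_mem (meas_compl (hV _)) x

theorem meas_pick {W V : Ω → ℕ → Set ℕ} (hW : ∀ k, Measurable fun ω => W ω k)
    (hV : ∀ k, Measurable fun ω => V ω k) {P : Ω → Set ℕ} (hP : Measurable P)
    {s : Ω → ℕ} (hs : Measurable s) (t : ℕ) :
    Measurable fun ω => pick (W ω) (V ω) t (P ω) (s ω) := by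
  have hfin : ∀ n, Measurable fun ω => finAbove n (s ω) := fun n =>
    (Measurable.of_discrete (f := fun s => finAbove n s)).comp hs
  have hH : ∀ n, Measurable fun ω => Hit (W ω) (V ω) t (P ω ∪ finAbove n (s ω)) := fun n =>
    meas_Hit hW hV (meas_union hP (hfin n)) t
  unfold pick
  refine measurable_find (p := fun ω n => pickP (W ω) (V ω) t (P ω) (s ω) n)
    (fun ω => pickP_ex (W ω) (V ω) t (P ω) (s ω)) fun n => ?_
  refine measurableSet_setOfPred.2 ?_
  exact (hH n).or (Measurable.forall fun m => (hH m).not)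

theorem meas_gen {W V : Ω → ℕ → Set ℕ} (hW : ∀ k, Measurable fun ω => W ω k)
    (hV : ∀ k, Measurable fun ω => V ω k) (D : ℕ → Set ℕ) (t : ℕ) :
    (Measurable fun ω => (gen (W ω) (V ω) D t).1) ∧
      Measurable fun ω => (gen (W ω) (V ω) D t).2 := by
  induction t with
  | zero => exact ⟨measurable_const, measurable_const⟩
  | succ t ih =>
    obtain ⟨h1, h2⟩ := ih
    have hp := meas_pick hW hV h1 h2 t
    have hpair := hp.prodMk h2
    constructor
    · refine meas_union (meas_union h1 ?_) ?_
      · exact (Measurable.of_discrete (f := fun q : ℕ × ℕ => finAbove q.1 q.2)).comp hpair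
      · exact (Measurable.of_discrete
          (f := fun q : ℕ × ℕ => colSet (q.2 + q.1 + 1) (D t))).comp hpair
    · exact (Measurable.of_discrete (f := fun q : ℕ × ℕ => q.2 + q.1 + 2)).comp hpair

theorem meas_genSet {W V : Ω → ℕ → Set ℕ} (hW : ∀ k, Measurable fun ω => W ω k)
    (hV : ∀ k, Measurable fun ω => V ω k) (D : ℕ → Set ℕ) :
    Measurable fun ω => genSet (W ω) (V ω) D :=
  measurable_set_iff.2 fun n => Measurable.exists fun t => meas_mem (meas_gen hW hV D t).1 n

end Meas

/-! ## The generic set and the jump-like hierarchy -/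

noncomputable def hgen (C : Set ℕ) : Set ℕ :=
  genSet (fun k => eOp k C) (fun k => eOp k C) (fun _ => ∅)

theorem meas_hgen : Measurable hgen :=
  meas_genSet (fun k => meas_eOp measurable_id k) (fun k => meas_eOp measurable_id k) _

theorem hgen_not_eLe (C : Set ℕ) : ¬ ELe (hgen C) C := by
  rintro ⟨i, hi⟩
  exact genSet_ne _ _ _ (fun _ => rfl) i hi

theorem hgen_peel {C D B : Set ℕ} (hD : ELe D C) (hB : ELe B (eJoin D (hgen C)))
    (h : ELe Bᶜ B ∨ ELe B C) : ELe B D := by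
  obtain ⟨k, rfl⟩ := hD
  obtain ⟨t, ht⟩ := genSet_main (fun k => eOp k C) (fun k => eOp k C) (fun _ => ∅)
    (fun _ => ELe.refl _) k B hB h
  exact ht.trans (eJoin_eLe (ELe.refl _) (empty_eLe _))

noncomputable def JJ (X : Set ℕ) : Set ℕ :=
  eJoin X {x | x.unpair.2 ∈ hgen (eOp x.unpair.1 X)}

theorem meas_JJ : Measurable JJ := by
  refine meas_eJoin measurable_id (measurable_set_iff.2 fun n => ?_)
  exact meas_mem (meas_hgen.comp (meas_eOp measurable_id n.unpair.1)) n.unpair.2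

theorem eLe_JJ (X : Set ℕ) : ELe X (JJ X) := eLe_join_left _ _

theorem hgen_eLe_JJ (X : Set ℕ) : ELe (hgen X) (JJ X) := by
  obtain ⟨k, hk⟩ := ELe.refl X
  have h := section_eLe k {x | x.unpair.2 ∈ hgen (eOp x.unpair.1 X)}
  have h2 : {m | Nat.pair k m ∈ {x : ℕ | x.unpair.2 ∈ hgen (eOp x.unpair.1 X)}} = hgen X := by
    ext m
    simp only [Set.mem_ofPred_eq, Nat.unpair_pair]
    rw [← hk]
  rw [h2] at h
  exact h.trans (eLe_join_right _ _)

theorem JJ_mono {A B : Set ℕ} (h : ELe A B) : ELe (JJ A) (JJ B) := by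
  refine eJoin_eLe (h.trans (eLe_JJ B)) (ELe.trans ?_ (eLe_join_right _ _))
  obtain ⟨i, rfl⟩ := h
  obtain ⟨c, hc, hc2⟩ := comp_index i
  refine eLe_of_map (f := fun x => Nat.pair (c x.unpair.1) x.unpair.2) ?_ fun x => ?_
  · exact Primrec₂.natPair.comp (hc.comp (Primrec.fst.comp Primrec.unpair))
      (Primrec.snd.comp Primrec.unpair)
  · simp only [Set.mem_ofPred_eq, Nat.unpair_pair, hc2]

noncomputable def Jn : ℕ → Set ℕ → Set ℕ
  | 0, X => X
  | n + 1, X => JJ (Jn n X)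

theorem meas_Jn (n : ℕ) : Measurable (Jn n) := by
  induction n with
  | zero => exact measurable_id
  | succ n ih => exact meas_JJ.comp ih

theorem Jn_mono {A B : Set ℕ} (h : ELe A B) (n : ℕ) : ELe (Jn n A) (Jn n B) := by
  induction n with
  | zero => exact h
  | succ n ih => exact JJ_mono ih

theorem Jn_le {m n : ℕ} (h : m ≤ n) (X : Set ℕ) : ELe (Jn m X) (Jn n X) := by
  induction n, h using Nat.le_induction with
  | base => exact ELe.refl _
  | succ n _ ih => exact ih.trans (eLe_JJ _)

/-! ## The function -/

def QBody (A X B : Set ℕ) (n : ℕ) : Prop :=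
  ELe Xᶜ X ∧ (∀ m, ELe (eOp m A)ᶜ (eOp m A) → ELe (eOp m A) X) ∧
    ELe B (Jn (n + 1) X) ∧ ¬ ELe B (Jn n X)

def QQ (A : Set ℕ) : Set ℕ := {n | ∃ k l, QBody A (eOp k A) (eOp l A) n}

theorem mem_QQ {A : Set ℕ} {n : ℕ} : n ∈ QQ A ↔ ∃ X B, ELe X A ∧ ELe B A ∧ ELe Xᶜ X ∧
    (∀ T, ELe T A → ELe Tᶜ T → ELe T X) ∧ ELe B (Jn (n + 1) X) ∧ ¬ ELe B (Jn n X) := by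
  constructor
  · rintro ⟨k, l, h1, h2, h3, h4⟩
    refine ⟨_, _, ⟨k, rfl⟩, ⟨l, rfl⟩, h1, ?_, h3, h4⟩
    rintro T ⟨m, rfl⟩ hT
    exact h2 m hT
  · rintro ⟨X, B, ⟨k, rfl⟩, ⟨l, rfl⟩, h1, h2, h3, h4⟩
    exact ⟨k, l, h1, fun m hm => h2 _ ⟨m, rfl⟩ hm, h3, h4⟩

theorem QQ_sub {A B : Set ℕ} (h : EEquiv A B) : QQ A ⊆ QQ B := by
  intro n hn
  obtain ⟨X, C, h1, h2, h3, h4, h5⟩ := mem_QQ.1 hn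
  exact mem_QQ.2 ⟨X, C, h1.trans h.1, h2.trans h.1, h3, fun T hT => h4 T (hT.trans h.2), h5⟩

theorem QQ_congr {A B : Set ℕ} (h : EEquiv A B) : QQ A = QQ B :=
  Set.Subset.antisymm (QQ_sub h) (QQ_sub ⟨h.2, h.1⟩)

theorem meas_QQ : Measurable QQ := by
  have hi := fun k => meas_eOp (measurable_id (α := Set ℕ)) k
  refine measurable_set_iff.2 fun n => Measurable.exists fun k => Measurable.exists fun l => ?_
  refine (meas_ELe (meas_compl (hi k)) (hi k)).and (Measurable.and ?_ (Measurable.and ?_ ?_))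
  · exact Measurable.forall fun m =>
      (meas_ELe (meas_compl (hi m)) (hi m)).imp (meas_ELe (hi m) (hi k))
  · exact meas_ELe (hi l) ((meas_Jn (n + 1)).comp (hi k))
  · exact (meas_ELe (hi l) ((meas_Jn n).comp (hi k))).not

noncomputable def ff (A : Set ℕ) : Set ℕ := {n | ELt (QQ A) A ∧ n ∈ QQ A}

theorem ff_pos {A : Set ℕ} (h : ELt (QQ A) A) : ff A = QQ A := by
  ext n
  simp [ff, h]

theorem ff_neg {A : Set ℕ} (h : ¬ ELt (QQ A) A) : ff A = ∅ := by
  ext n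
  simp [ff, h]

theorem meas_ff : Measurable ff :=
  measurable_set_iff.2 fun n => ((meas_ELe meas_QQ measurable_id).and
    (meas_ELe measurable_id meas_QQ).not).and (meas_mem meas_QQ n)

theorem ELt_congr {A B : Set ℕ} (h : EEquiv A B) (hl : ELt (QQ A) A) : ELt (QQ B) B := by
  rw [← QQ_congr h]
  exact ⟨hl.1.trans h.1, fun hB => hl.2 (h.1.trans hB)⟩

theorem ff_congr {A B : Set ℕ} (h : EEquiv A B) : ff A = ff B := by
  by_cases hA : ELt (QQ A) A
  · rw [ff_pos hA, ff_pos (ELt_congr h hA), QQ_congr h]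
  · rw [ff_neg hA, ff_neg fun hB => hA (ELt_congr ⟨h.2, h.1⟩ hB)]

theorem ff_regressive {A : Set ℕ} (hA : ¬ IsCE A) : ELt (ff A) A := by
  by_cases h : ELt (QQ A) A
  · rw [ff_pos h]
    exact h
  · rw [ff_neg h]
    exact ⟨empty_eLe A, fun h' => hA (isCE_of_eLe_empty h')⟩

theorem exists_not_eLe (Y : Set ℕ) : ∃ W : Set ℕ, ¬ ELe W Y := by
  by_contra hcon
  push Not at hcon
  choose i hi using hcon
  have hinj : Function.Injective i := by
    intro A B hAB
    rw [hi A, hi B, hAB]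
  exact Function.cantor_injective i hinj

/-! ## Cofinality -/

section Cof
variable (X1 Y : Set ℕ)

noncomputable def DD : ℕ → Set ℕ
  | 0 => X1
  | t + 1 => if t ∈ Y then eJoin (DD t) (hgen (Jn t X1)) else DD t

theorem DD_succ (t : ℕ) : ELe (DD X1 Y t) (DD X1 Y (t + 1)) := by
  by_cases h : t ∈ Y
  · simp only [DD, if_pos h]
    exact eLe_join_left _ _
  · simp only [DD, if_neg h]
    exact ELe.refl _

theorem DD_le (t : ℕ) : ELe (DD X1 Y t) (Jn t X1) := by
  induction t with
  | zero => exact ELe.refl _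
  | succ t ih =>
    by_cases h : t ∈ Y
    · simp only [DD, if_pos h]
      exact eJoin_eLe (ih.trans (eLe_JJ _)) (hgen_eLe_JJ _)
    · simp only [DD, if_neg h]
      exact ih.trans (eLe_JJ _)

theorem DD_peel {B : Set ℕ} {s : ℕ} (hB : ELe Bᶜ B ∨ ELe B (Jn s X1)) (t : ℕ)
    (h : ELe B (DD X1 Y t)) : (ELe Bᶜ B → ELe B X1) ∧ (ELe B (Jn s X1) → ELe B (DD X1 Y s)) := by
  induction t with
  | zero =>
    refine ⟨fun _ => h, fun hs => ?_⟩
    clear hB hs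
    induction s with
    | zero => exact h
    | succ s ih => exact ih.trans (DD_succ X1 Y s)
  | succ t ih =>
    have key : (ELe Bᶜ B ∨ ELe B (Jn t X1)) → ELe B (DD X1 Y t) := by
      intro h'
      by_cases hY : t ∈ Y
      · simp only [DD, if_pos hY] at h
        exact hgen_peel (DD_le X1 Y t) h h'
      · simpa only [DD, if_neg hY] using h
    refine ⟨fun hc => (ih (key (Or.inl hc))).1 hc, fun hs => ?_⟩
    rcases Nat.lt_or_ge t s with hts | hts
    · obtain ⟨d, rfl⟩ : ∃ d, s = t + 1 + d := ⟨s - (t + 1), by omega⟩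
      have : ∀ d, ELe B (DD X1 Y (t + 1 + d)) := by
        intro d
        induction d with
        | zero => exact h
        | succ d ih => exact ih.trans (DD_succ X1 Y _)
      exact this d
    · exact (ih (key (Or.inr (hs.trans (Jn_le hts X1))))).2 hs

noncomputable def ZZ : Set ℕ :=
  genSet (fun _ => ∅) (fun j => eOp j.unpair.1 (Jn j.unpair.2 X1)) (DD X1 Y)

theorem DD_le_ZZ (t : ℕ) : ELe (DD X1 Y t) (ZZ X1 Y) := D_eLe_genSet _ _ _ t

theorem ZZ_low {B : Set ℕ} {s : ℕ} (hBZ : ELe B (ZZ X1 Y)) (hB : ELe Bᶜ B ∨ ELe B (Jn s X1)) :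
    (ELe Bᶜ B → ELe B X1) ∧ (ELe B (Jn s X1) → ELe B (DD X1 Y s)) := by
  have h : ELe Bᶜ B ∨ ∃ j : ℕ, B = eOp j.unpair.1 (Jn j.unpair.2 X1) := by
    rcases hB with hB | ⟨i, hi⟩
    · exact Or.inl hB
    · refine Or.inr ⟨Nat.pair i s, ?_⟩
      rw [Nat.unpair_pair]
      exact hi
  obtain ⟨t, ht⟩ := genSet_main (fun _ => ∅) (fun j => eOp j.unpair.1 (Jn j.unpair.2 X1))
    (DD X1 Y) (DD_succ X1 Y) 0 B (hBZ.trans (eLe_join_right _ _)) h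
  exact DD_peel X1 Y hB t (ht.trans (eJoin_eLe (empty_eLe _) (ELe.refl _)))

theorem QQ_ZZ (hX : ELe X1ᶜ X1) : QQ (ZZ X1 Y) = Y := by
  ext n
  rw [mem_QQ]
  constructor
  · rintro ⟨X, B, hXZ, hBZ, hXt, hmax, hB1, hB2⟩
    have h1 : ELe X X1 := (ZZ_low X1 Y (s := 0) hXZ (Or.inl hXt)).1 hXt
    have h2 : ELe X1 X := hmax X1 (DD_le_ZZ X1 Y 0) hX
    by_contra hn
    have h3 : ELe B (Jn (n + 1) X1) := hB1.trans (Jn_mono h1 _)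
    have h4 := (ZZ_low X1 Y hBZ (Or.inr h3)).2 h3
    simp only [DD, if_neg hn] at h4
    exact hB2 ((h4.trans (DD_le X1 Y n)).trans (Jn_mono h2 n))
  · intro hn
    refine ⟨X1, hgen (Jn n X1), DD_le_ZZ X1 Y 0, ?_, hX, ?_, hgen_eLe_JJ _, hgen_not_eLe _⟩
    · refine ELe.trans ?_ (DD_le_ZZ X1 Y (n + 1))
      simp only [DD, if_pos hn]
      exact eLe_join_right _ _
    · intro T hT hTt
      exact (ZZ_low X1 Y (s := 0) hT (Or.inl hTt)).1 hTt

end Cof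

theorem ff_cofinal (X Y : Set ℕ) : ∃ Z : Set ℕ, ELe X Z ∧ ff Z = Y := by
  obtain ⟨W, hW⟩ := exists_not_eLe Y
  obtain ⟨base, hbase⟩ : ∃ b, b = eJoin X (eJoin Y W) := ⟨_, rfl⟩
  obtain ⟨X1, hX1⟩ : ∃ b, b = eJoin base baseᶜ := ⟨_, rfl⟩
  have ht : ELe X1ᶜ X1 := hX1 ▸ compl_join_eLe base
  have hbZ : ELe base (ZZ X1 Y) := by
    refine ELe.trans ?_ (DD_le_ZZ X1 Y 0)
    rw [DD, hX1]
    exact eLe_join_left _ _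
  rw [hbase] at hbZ
  have hYW := (eLe_join_right X (eJoin Y W)).trans hbZ
  have hQ := QQ_ZZ X1 Y ht
  refine ⟨ZZ X1 Y, (eLe_join_left _ _).trans hbZ, ?_⟩
  rw [ff_pos, hQ]
  rw [hQ]
  exact ⟨(eLe_join_left _ _).trans hYW,
    fun h => hW (((eLe_join_right _ _).trans hYW).trans h)⟩

/-- There is a Borel uniformly e-invariant function `f` that takes every value
cofinally often and is regressive (`f(A) <ₑ A`) on all non-c.e. sets; in
particular `f` is not constant on any cone of enumeration degrees. -/
theorem exists_regressive_surjective_uniform :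
    ∃ f : Set ℕ → Set ℕ, BorelFun f ∧ UniformlyEInvariant f ∧
      (∀ X Y : Set ℕ, ∃ Z : Set ℕ, ELe X Z ∧ f Z = Y) ∧
      (∀ A : Set ℕ, ¬ IsCE A → ELt (f A) A) ∧
      ¬ ∃ D : Set ℕ, ∀ X Y : Set ℕ, ELe D X → ELe D Y → EEquiv (f X) (f Y) := by
  refine ⟨ff, meas_ff, ?_, ff_cofinal, fun A hA => ff_regressive hA, ?_⟩
  · obtain ⟨i0, hi0⟩ : ∃ i, ∀ A, eOp i A = A := by
      obtain ⟨c, -, hc⟩ := Sig.eOp (R := fun x => x.2.1 ∈ x.2.2) (Sig.of_prim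
        (prim_mem.comp (Primrec.fst.comp Primrec.snd) (Primrec.snd.comp Primrec.snd)))
      refine ⟨c 0, fun A => ?_⟩
      rw [hc]
      ext n
      constructor
      · rintro ⟨l, h1, h2⟩
        exact h2 _ h1
      · intro hn
        exact ⟨[n], by simp, by simpa using hn⟩
    refine ⟨fun _ => Nat.pair i0 i0, ?_⟩
    intro A _ B _ i j h
    have hAB : ff A = ff B := ff_congr ⟨⟨i, h.1⟩, ⟨j, h.2⟩⟩
    simp only [Nat.unpair_pair]
    refine ⟨?_, ?_⟩
    · rw [ELeVia, hi0, hAB]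
    · rw [ELeVia, hi0, hAB]
  · rintro ⟨D, hD⟩
    obtain ⟨W, hW⟩ := exists_not_eLe ∅
    obtain ⟨Z1, h1, e1⟩ := ff_cofinal D ∅
    obtain ⟨Z2, h2, e2⟩ := ff_cofinal D W
    have h := (hD Z2 Z1 h2 h1).1
    rw [e1, e2] at h
    exact hW h
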